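/- Suppose the constants satisfy condition (C3): α_v^{ii} = 0 for all v ∈ [d], i ∈ [m], and Σ_{u=1}^d Σ_{j≠i} |α_u^{ij}| < 4 for each i ∈ [m]. Then the vector field F has a unique equilibrium point x* in 𝔇, and the vertex occupation measure process X(n) converges almost surely to x*. -/

import Mathlib

open Filter MeasureTheory

def simplexD (d m : ℕ) : Set (Fin m → Fin d → ℝ) :=
  {x | ∀ i, (∀ v, 0 ≤ x i v) ∧ (∑ v, x i v) = 1}

noncomputable def piMap (d m : ℕ) (α : Fin d → Fin m → Fin m → ℝ)
    (x : Fin m → Fin d → ℝ) : Fin m → Fin d → ℝ :=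
  fun i v => Real.exp (∑ j, α v i j * x j v) / ∑ u, Real.exp (∑ j, α u i j * x j u)

noncomputable def FF (d m : ℕ) (α : Fin d → Fin m → Fin m → ℝ)
    (x : Fin m → Fin d → ℝ) : Fin m → Fin d → ℝ :=
  fun i v => -(x i v) + piMap d m α x i v

noncomputable def occ (d m : ℕ) {Ω : Type*} (W : ℕ → Ω → Fin m → Fin d)
    (n : ℕ) (ω : Ω) : Fin m → Fin d → ℝ :=
  fun i v => (1 + ∑ k ∈ Finset.Icc 1 n, if W k ω i = v then (1 : ℝ) else 0) / (d + n)

open Finset in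
/-- A strong law of large numbers for martingale differences bounded by one. -/
theorem ae_tendsto_average_of_condExp_eq_zero {Ω : Type*} {mΩ : MeasurableSpace Ω}
    {μ : Measure Ω} [IsProbabilityMeasure μ] {ℱ : Filtration ℕ mΩ} {D : ℕ → Ω → ℝ}
    (hmeas : ∀ n, StronglyMeasurable[ℱ (n + 1)] (D n)) (hbdd : ∀ n ω, |D n ω| ≤ 1)
    (hzero : ∀ n, μ[D n | ℱ n] =ᵐ[μ] 0) :
    ∀ᵐ ω ∂μ, Tendsto (fun n : ℕ => (n : ℝ)⁻¹ * ∑ k ∈ range n, D k ω) atTop (nhds 0) := by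
  set T : ℕ → Ω → ℝ := fun n ω => ∑ k ∈ range n, D k ω / (k + 1) with hT
  have hTsucc : ∀ n ω, T (n + 1) ω = T n ω + D n ω / (n + 1) := fun n ω => by
    simp [hT, sum_range_succ]
  have hadp : StronglyAdapted ℱ T := fun n => by
    have h : ∀ k ∈ range n, StronglyMeasurable[ℱ n] fun ω => D k ω / ((k : ℝ) + 1) := by
      intro k hk
      have h1 := (hmeas k).mono (ℱ.mono (Finset.mem_range.1 hk))
      simpa only [div_eq_mul_inv] using h1.mul_const _
    exact Finset.stronglyMeasurable_fun_sum _ h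
  have hTbdd : ∀ n ω, |T n ω| ≤ n := fun n ω => by
    refine (abs_sum_le_sum_abs _ _).trans ?_
    calc ∑ k ∈ range n, |D k ω / ((k : ℝ) + 1)| ≤ ∑ k ∈ range n, (1 : ℝ) := by
          refine sum_le_sum fun k _ => ?_
          rw [abs_div, abs_of_pos (by positivity : (0 : ℝ) < k + 1), div_le_one (by positivity)]
          exact (hbdd k ω).trans (by simp)
      _ = n := by simp
  have hTm : ∀ n, AEStronglyMeasurable (T n) μ := fun n =>
    ((hadp n).mono (ℱ.le n)).aestronglyMeasurable
  have hDm : ∀ n, AEStronglyMeasurable (D n) μ := fun n =>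
    ((hmeas n).mono (ℱ.le _)).aestronglyMeasurable
  have hTint : ∀ n, Integrable (T n) μ := fun n =>
    .of_bound (hTm n) n (ae_of_all _ (hTbdd n))
  have hDint : ∀ n, Integrable (D n) μ := fun n =>
    .of_bound (hDm n) 1 (ae_of_all _ (hbdd n))
  have hmart : Martingale T ℱ μ := by
    refine martingale_of_condExp_sub_eq_zero_nat hadp hTint fun n => ?_
    have h : T (n + 1) - T n = ((n : ℝ) + 1)⁻¹ • D n := by
      ext ω
      simp only [Pi.sub_apply, hTsucc, Pi.smul_apply, smul_eq_mul]
      ring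
    rw [h]
    filter_upwards [condExp_smul ((n : ℝ) + 1)⁻¹ (D n) (ℱ n) (μ := μ), hzero n] with ω h1 h2
    simp [h1, h2]
  have hTDint : ∀ n, Integrable (T n * D n) μ := fun n =>
    (hDint n).bdd_mul (hTm n) (ae_of_all _ (hTbdd n))
  have horth : ∀ n, ∫ ω, T n ω * D n ω ∂μ = 0 := fun n => by
    have h := condExp_mul_of_stronglyMeasurable_left (hadp n) (hTDint n) (hDint n)
    have h' : ∫ ω, (T n * D n) ω ∂μ = 0 := by
      rw [← integral_condExp (ℱ.le n), integral_congr_ae h]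
      refine integral_eq_zero_of_ae ?_
      filter_upwards [hzero n] with ω hω
      simp [hω]
    exact h'
  have hT2int : ∀ n, Integrable (fun ω => T n ω ^ 2) μ := fun n => by
    simpa only [pow_two] using (hTint n).bdd_mul (hTm n) (ae_of_all _ (hTbdd n))
  have hD2int : ∀ n, Integrable (fun ω => D n ω ^ 2) μ := fun n => by
    simpa only [pow_two] using (hDint n).bdd_mul (hDm n) (ae_of_all _ (hbdd n))
  have hsq : ∀ n : ℕ, ∫ ω, T n ω ^ 2 ∂μ ≤ 2 - 2 / ((n : ℝ) + 1) := by
    intro n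
    induction n with
    | zero => simp [hT]
    | succ n ih =>
      have hexp : ∀ ω, T (n + 1) ω ^ 2 = T n ω ^ 2 + 2 / ((n : ℝ) + 1) * (T n ω * D n ω)
          + (1 / ((n : ℝ) + 1) ^ 2) * D n ω ^ 2 := fun ω => by
        rw [hTsucc]; field_simp; ring
      have hD2 : ∫ ω, D n ω ^ 2 ∂μ ≤ 1 := by
        calc ∫ ω, D n ω ^ 2 ∂μ ≤ ∫ _, (1 : ℝ) ∂μ :=
              integral_mono (hD2int n) (integrable_const _) fun ω =>
                (sq_le_one_iff_abs_le_one _).2 (hbdd n ω)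
          _ = 1 := by simp
      have hTD : Integrable (fun ω => 2 / ((n : ℝ) + 1) * (T n ω * D n ω)) μ :=
        (hTDint n).const_mul _
      have hadd : Integrable
          (fun ω => T n ω ^ 2 + 2 / ((n : ℝ) + 1) * (T n ω * D n ω)) μ := (hT2int n).add hTD
      simp_rw [hexp]
      rw [integral_add hadd ((hD2int n).const_mul _),
        integral_add (hT2int n) hTD, integral_const_mul, integral_const_mul, horth]
      have h1 : 1 / ((n : ℝ) + 1) ^ 2 * ∫ ω, D n ω ^ 2 ∂μ ≤ 1 / ((n : ℝ) + 1) ^ 2 * 1 := by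
        gcongr
      have h2 : 1 / ((n : ℝ) + 1) ^ 2 ≤ 2 / ((n : ℝ) + 1) - 2 / ((n : ℝ) + 1 + 1) := by
        rw [div_sub_div _ _ (by positivity) (by positivity),
          div_le_div_iff₀ (by positivity) (by positivity)]
        have : (0 : ℝ) ≤ n := n.cast_nonneg
        nlinarith [mul_nonneg this (sq_nonneg ((n : ℝ) + 1))]
      push_cast
      linarith
  have hL1 : ∀ n, eLpNorm (T n) 1 μ ≤ (3 : NNReal) := fun n => by
    rw [eLpNorm_one_eq_lintegral_enorm, ← ofReal_integral_norm_eq_lintegral_enorm (hTint n)]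
    refine ENNReal.ofReal_le_of_le_toReal ?_
    calc ∫ ω, ‖T n ω‖ ∂μ ≤ ∫ ω, (T n ω ^ 2 + 1) ∂μ := by
          refine integral_mono (hTint n).norm ((hT2int n).add (integrable_const _)) fun ω => ?_
          simp only [Real.norm_eq_abs]
          nlinarith [sq_abs (T n ω), sq_nonneg (|T n ω| - 1)]
      _ = ∫ ω, T n ω ^ 2 ∂μ + 1 := by
          rw [integral_add (hT2int n) (integrable_const _)]; simp
      _ ≤ 3 := by
          have : 0 ≤ 2 / ((n : ℝ) + 1) := by positivity
          linarith [hsq n]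
      _ = _ := by simp
  filter_upwards [hmart.submartingale.exists_ae_tendsto_of_bdd hL1] with ω ⟨c, hc⟩
  have hsum : ∀ n : ℕ, ∑ k ∈ range n, D k ω = n * T n ω - ∑ k ∈ range n, T k ω := by
    intro n
    induction n with
    | zero => simp
    | succ n ih =>
      rw [sum_range_succ, sum_range_succ, ih, hTsucc]
      push_cast
      field_simp
      ring
  have hlim := hc.sub hc.cesaro
  rw [sub_self] at hlim
  refine hlim.congr' ?_
  filter_upwards [eventually_gt_atTop 0] with n hn
  have : (n : ℝ) ≠ 0 := by positivity
  rw [hsum, mul_sub, inv_mul_cancel_left₀ this]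

open Finset in
/-- A bounded nonnegative sequence dominated, up to a vanishing error, by a fraction `K < 1` of
its Cesàro averages tends to zero. -/
theorem tendsto_zero_of_le_mul_cesaro {a e : ℕ → ℝ} {K B : ℝ} (hK0 : 0 ≤ K) (hK1 : K < 1)
    (ha0 : ∀ n, 0 ≤ a n) (haB : ∀ n, a n ≤ B) (he : Tendsto e atTop (nhds 0))
    (h : ∀ᶠ n : ℕ in atTop, a n ≤ K * ((n : ℝ)⁻¹ * ∑ k ∈ range n, a k) + e n) :
    Tendsto a atTop (nhds 0) := by
  have hbdd : IsBoundedUnder (· ≤ ·) atTop a := isBoundedUnder_of ⟨B, haB⟩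
  have hbdd' : IsBoundedUnder (· ≥ ·) atTop a := isBoundedUnder_of ⟨0, ha0⟩
  set L := limsup a atTop with hL
  have hL0 : L ≤ 0 := by
    by_contra! hpos
    set M := L + (1 - K) * L / 2 with hM
    have hLM : L < M := by
      have : 0 < (1 - K) * L := mul_pos (by linarith) hpos
      linarith
    have hKM : K * M < L := by
      have : 0 < (1 - K) * L := mul_pos (by linarith) hpos
      nlinarith [mul_pos this (by linarith : 0 < 1 - K)]
    have hev : ∀ᶠ n in atTop, a n < M := eventually_lt_of_limsup_lt hLM hbdd
    have hmax : Tendsto (fun n => max (a n) M) atTop (nhds M) :=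
      tendsto_const_nhds.congr' (by
        filter_upwards [hev] with n hn using (max_eq_right hn.le).symm)
    have hlim := (hmax.cesaro.const_mul K).add he
    rw [add_zero] at hlim
    obtain ⟨N, hKN, hNL⟩ := exists_between hKM
    have hle : ∀ᶠ n in atTop, a n ≤ N := by
      filter_upwards [h, hlim.eventually_lt_const hKN] with n h1 h2
      refine h1.trans (le_trans ?_ h2.le)
      gcongr
      exact le_max_left _ _
    have : L ≤ N := limsup_le_of_le hbdd'.isCoboundedUnder_le hle
    linarith
  refine tendsto_order.2 ⟨fun b hb => .of_forall fun n => hb.trans_le (ha0 n), fun b hb => ?_⟩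
  exact eventually_lt_of_limsup_lt (hL0.trans_lt hb) hbdd

/-- The softmax map is `1/2`-Lipschitz for the `ℓ¹` norm. -/
theorem sum_abs_softmax_sub_le {ι : Type*} [Fintype ι] [Nonempty ι] (g h : ι → ℝ) :
    ∑ v, |Real.exp (g v) / ∑ u, Real.exp (g u) - Real.exp (h v) / ∑ u, Real.exp (h u)|
      ≤ 1 / 2 * ∑ v, |g v - h v| := by
  classical
  set f : ℝ → ι → ℝ := fun t v =>
    Real.exp (h v + t * (g v - h v)) / ∑ u, Real.exp (h u + t * (g u - h u)) with hf
  set s : ι → ℝ := fun v => SignType.sign (f 1 v - f 0 v) with hs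
  have hZ : ∀ t : ℝ, 0 < ∑ u, Real.exp (h u + t * (g u - h u)) := fun t =>
    Finset.sum_pos (fun u _ => Real.exp_pos _) Finset.univ_nonempty
  have hf0 : ∀ t v, 0 ≤ f t v := fun t v => div_nonneg (Real.exp_pos _).le (hZ t).le
  have hf1 : ∀ t, ∑ v, f t v = 1 := fun t => by
    simp only [hf]
    rw [← Finset.sum_div, div_self (hZ t).ne']
  have hs1 : ∀ v, |s v| ≤ 1 := fun v => by
    simp only [hs]
    rcases lt_trichotomy (f 1 v - f 0 v) 0 with hv | hv | hv
    · simp [sign_neg hv]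
    · simp [hv]
    · simp [sign_pos hv]
  have hexp : ∀ t v, HasDerivAt (fun t : ℝ => Real.exp (h v + t * (g v - h v)))
      (Real.exp (h v + t * (g v - h v)) * (g v - h v)) t := fun t v => by
    have := (((hasDerivAt_id t).mul_const (g v - h v)).const_add (h v)).exp
    simpa using this
  have hderiv : ∀ t v, HasDerivAt (fun t => f t v)
      (f t v * ((g v - h v) - ∑ u, f t u * (g u - h u))) t := fun t v => by
    have h1 := (hexp t v).div (HasDerivAt.fun_sum fun u (_ : u ∈ Finset.univ) => hexp t u)
      (hZ t).ne'
    refine h1.congr_deriv ?_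
    simp only [hf, div_mul_eq_mul_div, ← Finset.sum_div]
    have := (hZ t).ne'
    field_simp
  have hφ : ∀ t, HasDerivAt (fun t => ∑ v, s v * f t v)
      (∑ v, s v * (f t v * ((g v - h v) - ∑ u, f t u * (g u - h u)))) t := fun t =>
    HasDerivAt.fun_sum fun v _ => (hderiv t v).const_mul (s v)
  have hbound : ∀ t, ‖∑ v, s v * (f t v * ((g v - h v) - ∑ u, f t u * (g u - h u)))‖
      ≤ 1 / 2 * ∑ v, |g v - h v| := fun t => by
    have hswap : ∑ v, s v * (f t v * ((g v - h v) - ∑ u, f t u * (g u - h u)))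
        = ∑ u, f t u * (s u - ∑ v, f t v * s v) * (g u - h u) := by
      have e1 : ∀ v, s v * (f t v * ((g v - h v) - ∑ u, f t u * (g u - h u)))
          = f t v * s v * (g v - h v) - f t v * s v * ∑ u, f t u * (g u - h u) :=
        fun v => by ring
      have e2 : ∀ u, f t u * (s u - ∑ v, f t v * s v) * (g u - h u)
          = f t u * s u * (g u - h u) - (∑ v, f t v * s v) * (f t u * (g u - h u)) :=
        fun v => by ring
      simp_rw [e1, e2]
      rw [Finset.sum_sub_distrib, Finset.sum_sub_distrib, ← Finset.sum_mul, ← Finset.mul_sum]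
    rw [hswap, Real.norm_eq_abs, Finset.mul_sum]
    refine (Finset.abs_sum_le_sum_abs _ _).trans (Finset.sum_le_sum fun u _ => ?_)
    rw [abs_mul]
    gcongr
    have hu : s u - ∑ v, f t v * s v
        = (1 - f t u) * s u - ∑ v ∈ Finset.univ.erase u, f t v * s v := by
      rw [← Finset.add_sum_erase _ _ (Finset.mem_univ u)]; ring
    have hrest : ∑ v ∈ Finset.univ.erase u, f t v = 1 - f t u := by
      rw [← hf1 t, ← Finset.add_sum_erase _ _ (Finset.mem_univ u)]; ring
    have h1u : 0 ≤ 1 - f t u := by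
      rw [← hrest]; exact Finset.sum_nonneg fun v _ => hf0 t v
    have habs : |s u - ∑ v, f t v * s v| ≤ 2 * (1 - f t u) := by
      rw [hu]
      refine (abs_sub _ _).trans ?_
      have a1 : |(1 - f t u) * s u| ≤ 1 - f t u := by
        rw [abs_mul, abs_of_nonneg h1u]
        exact mul_le_of_le_one_right h1u (hs1 u)
      have a2 : |∑ v ∈ Finset.univ.erase u, f t v * s v| ≤ 1 - f t u := by
        rw [← hrest]
        refine (Finset.abs_sum_le_sum_abs _ _).trans (Finset.sum_le_sum fun v _ => ?_)
        rw [abs_mul, abs_of_nonneg (hf0 t v)]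
        exact mul_le_of_le_one_right (hf0 t v) (hs1 v)
      linarith
    rw [abs_mul, abs_of_nonneg (hf0 t u)]
    calc f t u * |s u - ∑ v, f t v * s v| ≤ f t u * (2 * (1 - f t u)) := by
          gcongr
      _ ≤ 1 / 2 := by nlinarith [sq_nonneg (2 * f t u - 1)]
  have hmvt := convex_univ.norm_image_sub_le_of_norm_hasDerivWithin_le
    (fun t (_ : t ∈ Set.univ) => (hφ t).hasDerivWithinAt) (fun t _ => hbound t)
    (Set.mem_univ (0 : ℝ)) (Set.mem_univ (1 : ℝ))
  have hsum : ∑ v, s v * f 1 v - ∑ v, s v * f 0 v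
      = ∑ v, |Real.exp (g v) / ∑ u, Real.exp (g u) - Real.exp (h v) / ∑ u, Real.exp (h u)| := by
    rw [← Finset.sum_sub_distrib]
    refine Finset.sum_congr rfl fun v _ => ?_
    rw [← mul_sub, hs, sign_mul_self]
    simp [hf]
  rw [hsum] at hmvt
  simpa using (le_abs_self _).trans hmvt

/-- The largest `ℓ¹` norm among the components of a vector indexed by particles and vertices. -/
noncomputable def maxL1 {d m : ℕ} (x : Fin m → Fin d → ℝ) : ℝ := ‖fun i => ∑ v, |x i v|‖

section maxL1

variable {d m : ℕ}

theorem sum_abs_le_maxL1 (x : Fin m → Fin d → ℝ) (i : Fin m) : ∑ v, |x i v| ≤ maxL1 x :=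
  (le_abs_self _).trans (norm_le_pi_norm (fun i => ∑ v, |x i v|) i)

theorem maxL1_nonneg (x : Fin m → Fin d → ℝ) : 0 ≤ maxL1 x := norm_nonneg _

theorem maxL1_le {x : Fin m → Fin d → ℝ} {r : ℝ} (hr : 0 ≤ r) (h : ∀ i, ∑ v, |x i v| ≤ r) :
    maxL1 x ≤ r := by
  refine (pi_norm_le_iff_of_nonneg hr).2 fun i => ?_
  rw [Real.norm_of_nonneg (Finset.sum_nonneg fun v _ => abs_nonneg _)]
  exact h i

theorem norm_le_maxL1 (x : Fin m → Fin d → ℝ) : ‖x‖ ≤ maxL1 x := by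
  refine (pi_norm_le_iff_of_nonneg (maxL1_nonneg x)).2 fun i => ?_
  refine (pi_norm_le_iff_of_nonneg (maxL1_nonneg x)).2 fun v => ?_
  exact (Finset.single_le_sum (f := fun v => |x i v|) (fun v _ => abs_nonneg _)
    (Finset.mem_univ v)).trans (sum_abs_le_maxL1 x i)

@[fun_prop]
theorem continuous_maxL1 : Continuous (maxL1 : (Fin m → Fin d → ℝ) → ℝ) := by
  unfold maxL1
  fun_prop

end maxL1

theorem isCompact_simplexD (d m : ℕ) : IsCompact (simplexD d m) := by
  have h : simplexD d m = Set.univ.pi fun _ : Fin m => stdSimplex ℝ (Fin d) := by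
    ext x
    simp [simplexD, stdSimplex]
  rw [h]
  exact isCompact_univ_pi fun _ => isCompact_stdSimplex ℝ _

section piMap

variable {d m : ℕ} (α : Fin d → Fin m → Fin m → ℝ)

theorem sum_exp_pos (hd : 0 < d) (g : Fin d → ℝ) : 0 < ∑ u, Real.exp (g u) :=
  Finset.sum_pos (fun _ _ => Real.exp_pos _) ⟨⟨0, hd⟩, Finset.mem_univ _⟩

theorem piMap_mem_simplexD (hd : 0 < d) (x : Fin m → Fin d → ℝ) :
    piMap d m α x ∈ simplexD d m := fun i => by
  refine ⟨fun v => div_nonneg (Real.exp_pos _).le (sum_exp_pos hd _).le, ?_⟩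
  simp only [piMap]
  rw [← Finset.sum_div, div_self (sum_exp_pos hd _).ne']

theorem continuous_piMap (hd : 0 < d) : Continuous (piMap d m α) := by
  refine continuous_pi fun i => continuous_pi fun v => ?_
  unfold piMap
  exact Continuous.div (by fun_prop) (by fun_prop) fun x => (sum_exp_pos hd _).ne'

theorem abs_sub_le_of_mem_simplexD {x y : Fin m → Fin d → ℝ} (hx : x ∈ simplexD d m)
    (hy : y ∈ simplexD d m) (i : Fin m) (v : Fin d) :
    |x i v - y i v| ≤ 1 / 2 * maxL1 (x - y) := by
  have hz : ∑ u, (x i u - y i u) = 0 := by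
    rw [Finset.sum_sub_distrib, (hx i).2, (hy i).2, sub_self]
  rw [← Finset.add_sum_erase _ _ (Finset.mem_univ v)] at hz
  have h1 : |x i v - y i v| ≤ ∑ u ∈ Finset.univ.erase v, |x i u - y i u| := by
    rw [eq_neg_of_add_eq_zero_left hz, abs_neg]
    exact Finset.abs_sum_le_sum_abs _ _
  have h2 := sum_abs_le_maxL1 (x - y) i
  simp only [Pi.sub_apply] at h2
  rw [← Finset.add_sum_erase _ _ (Finset.mem_univ v)] at h2
  linarith

/-- The constant by which the softmax dynamics contracts the simplex in the norm `maxL1`. -/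
noncomputable def contractionConst : ℝ :=
  1 / 4 * ‖fun i : Fin m => ∑ u, ∑ j, |α u i j|‖

theorem contractionConst_nonneg : 0 ≤ contractionConst α := by
  unfold contractionConst
  positivity

theorem contractionConst_lt_one (hα : ∀ i, ∑ u, ∑ j, |α u i j| < 4) :
    contractionConst α < 1 := by
  have : ‖fun i : Fin m => ∑ u, ∑ j, |α u i j|‖ < 4 := by
    refine (pi_norm_lt_iff (by norm_num)).2 fun i => ?_
    rw [Real.norm_of_nonneg (by positivity)]
    exact hα i
  unfold contractionConst
  linarith

theorem sum_abs_piMap_sub_le (hd : 0 < d) {x y : Fin m → Fin d → ℝ} (hx : x ∈ simplexD d m)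
    (hy : y ∈ simplexD d m) (i : Fin m) :
    ∑ v, |piMap d m α x i v - piMap d m α y i v| ≤ contractionConst α * maxL1 (x - y) := by
  have : Nonempty (Fin d) := ⟨⟨0, hd⟩⟩
  refine (sum_abs_softmax_sub_le _ _).trans ?_
  calc 1 / 2 * ∑ v, |∑ j, α v i j * x j v - ∑ j, α v i j * y j v|
      ≤ 1 / 2 * ∑ v, ∑ j, |α v i j| * (1 / 2 * maxL1 (x - y)) := by
        gcongr with v
        rw [← Finset.sum_sub_distrib]
        refine (Finset.abs_sum_le_sum_abs _ _).trans (Finset.sum_le_sum fun j _ => ?_)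
        rw [← mul_sub, abs_mul]
        gcongr
        exact abs_sub_le_of_mem_simplexD hx hy j v
    _ = 1 / 4 * (∑ v, ∑ j, |α v i j|) * maxL1 (x - y) := by
        simp_rw [← Finset.sum_mul]
        ring
    _ ≤ contractionConst α * maxL1 (x - y) := by
        unfold contractionConst
        gcongr
        · exact maxL1_nonneg _
        · exact (le_abs_self _).trans
            (norm_le_pi_norm (fun i : Fin m => ∑ u, ∑ j, |α u i j|) i)

theorem maxL1_piMap_sub_le (hd : 0 < d) {x y : Fin m → Fin d → ℝ} (hx : x ∈ simplexD d m)
    (hy : y ∈ simplexD d m) :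
    maxL1 (piMap d m α x - piMap d m α y) ≤ contractionConst α * maxL1 (x - y) :=
  maxL1_le (mul_nonneg (contractionConst_nonneg α) (maxL1_nonneg _)) fun i =>
    sum_abs_piMap_sub_le α hd hx hy i

theorem eq_of_maxL1_sub_le_mul {x y : Fin m → Fin d → ℝ} {K : ℝ} (hK : K < 1)
    (h : maxL1 (x - y) ≤ K * maxL1 (x - y)) : x = y := by
  have h0 := maxL1_nonneg (x - y)
  have : maxL1 (x - y) = 0 := by nlinarith
  have hn := norm_le_maxL1 (x - y)
  rw [this] at hn
  exact sub_eq_zero.1 (norm_le_zero_iff.1 hn)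

theorem exists_piMap_eq (hd : 0 < d) (hK : contractionConst α < 1) :
    ∃ x ∈ simplexD d m, piMap d m α x = x := by
  have hcont := continuous_piMap α hd
  obtain ⟨x, hx, hmin⟩ := (isCompact_simplexD d m).exists_isMinOn
    ⟨_, piMap_mem_simplexD α hd 0⟩
    (f := fun x => maxL1 (piMap d m α x - x)) (by fun_prop)
  refine ⟨x, hx, eq_of_maxL1_sub_le_mul hK ?_⟩
  have hπx := piMap_mem_simplexD α hd x
  exact (isMinOn_iff.1 hmin _ hπx).trans (maxL1_piMap_sub_le α hd hπx hx)

end piMap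

theorem FF_eq_zero_iff {d m : ℕ} (α : Fin d → Fin m → Fin m → ℝ) (x : Fin m → Fin d → ℝ) :
    FF d m α x = 0 ↔ piMap d m α x = x := by
  have : FF d m α x = piMap d m α x - x := by
    ext i v
    simp only [FF, Pi.sub_apply]
    ring
  rw [this, sub_eq_zero]

section occ

variable {d m : ℕ} {Ω : Type*} (W : ℕ → Ω → Fin m → Fin d)

theorem occ_eq (n : ℕ) (ω : Ω) (i : Fin m) (v : Fin d) :
    occ d m W n ω i v
      = (1 + ∑ k ∈ Finset.range n, if W (k + 1) ω i = v then (1 : ℝ) else 0) / (d + n) := by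
  rw [Finset.range_eq_Ico, Finset.sum_Ico_add' (fun k => if W k ω i = v then (1 : ℝ) else 0)]
  rfl

theorem occ_mem_simplexD (hd : 0 < d) (n : ℕ) (ω : Ω) : occ d m W n ω ∈ simplexD d m := by
  have hdn : (0 : ℝ) < d + n := by positivity
  refine fun i => ⟨fun v => ?_, ?_⟩
  · refine div_nonneg (add_nonneg zero_le_one (Finset.sum_nonneg fun k _ => ?_)) hdn.le
    split_ifs <;> norm_num
  · simp_rw [occ_eq]
    rw [← Finset.sum_div, Finset.sum_add_distrib, Finset.sum_comm]
    simp [hdn.ne']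

theorem stronglyMeasurable_visit {mΩ : MeasurableSpace Ω} {ℱ : Filtration ℕ mΩ}
    (hℱ : ∀ n, ℱ n = ⨆ k ∈ Finset.Icc 1 n, MeasurableSpace.comap (W k) ⊤) {k n : ℕ}
    (hk : k ∈ Finset.Icc 1 n) (i : Fin m) (v : Fin d) :
    StronglyMeasurable[ℱ n] fun ω => if W k ω i = v then (1 : ℝ) else 0 := by
  have hle : MeasurableSpace.comap (W k) ⊤ ≤ ℱ n := by
    rw [hℱ]
    exact le_iSup₂_of_le k hk le_rfl
  refine StronglyMeasurable.mono ?_ hle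
  refine Measurable.stronglyMeasurable ?_
  exact (measurable_from_top (f := fun w : Fin m → Fin d => if w i = v then (1 : ℝ) else 0)).comp
    (comap_measurable (W k))

theorem stronglyMeasurable_occ {mΩ : MeasurableSpace Ω} {ℱ : Filtration ℕ mΩ}
    (hℱ : ∀ n, ℱ n = ⨆ k ∈ Finset.Icc 1 n, MeasurableSpace.comap (W k) ⊤) (n : ℕ)
    (i : Fin m) (v : Fin d) : StronglyMeasurable[ℱ n] fun ω => occ d m W n ω i v := by
  simp only [occ, div_eq_mul_inv]
  refine StronglyMeasurable.mul_const (stronglyMeasurable_const.add ?_) _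
  exact Finset.stronglyMeasurable_fun_sum _ fun k hk => stronglyMeasurable_visit W hℱ hk i v

theorem stronglyMeasurable_piMap_occ (hd : 0 < d) {mΩ : MeasurableSpace Ω} {ℱ : Filtration ℕ mΩ}
    (hℱ : ∀ n, ℱ n = ⨆ k ∈ Finset.Icc 1 n, MeasurableSpace.comap (W k) ⊤)
    (α : Fin d → Fin m → Fin m → ℝ) (n : ℕ) (i : Fin m) (v : Fin d) :
    StronglyMeasurable[ℱ n] fun ω => piMap d m α (occ d m W n ω) i v := by
  have hocc : Measurable[ℱ n] fun ω => occ d m W n ω :=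
    @measurable_pi_lambda _ _ _ (ℱ n) _ _ fun i => @measurable_pi_lambda _ _ _ (ℱ n) _ _ fun v =>
      (stronglyMeasurable_occ W hℱ n i v).measurable
  have hpi : Measurable fun x => piMap d m α x i v :=
    ((continuous_apply v).comp ((continuous_apply i).comp (continuous_piMap α hd))).measurable
  have hcomp : Measurable[ℱ n] fun ω => piMap d m α (occ d m W n ω) i v := hpi.comp hocc
  exact hcomp.stronglyMeasurable

/-- The average discrepancy between the visits to a vertex and their conditional probabilities
vanishes almost surely. -/
theorem ae_tendsto_average_visit_sub_piMap (hd : 0 < d) {mΩ : MeasurableSpace Ω}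
    {μ : Measure Ω} [IsProbabilityMeasure μ] {ℱ : Filtration ℕ mΩ}
    (hℱ : ∀ n, ℱ n = ⨆ k ∈ Finset.Icc 1 n, MeasurableSpace.comap (W k) ⊤)
    (α : Fin d → Fin m → Fin m → ℝ) (i : Fin m) (v : Fin d)
    (hcond : ∀ n, (μ[fun ω => if W (n + 1) ω i = v then (1 : ℝ) else 0 | ℱ n])
        =ᵐ[μ] fun ω => piMap d m α (occ d m W n ω) i v) :
    ∀ᵐ ω ∂μ, Tendsto (fun n : ℕ => (n : ℝ)⁻¹ * ∑ k ∈ Finset.range n,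
      ((if W (k + 1) ω i = v then (1 : ℝ) else 0) - piMap d m α (occ d m W k ω) i v))
      atTop (nhds 0) := by
  have hπ := fun n => stronglyMeasurable_piMap_occ W hd hℱ α n i v
  have hI := fun n => stronglyMeasurable_visit W hℱ
    (Finset.mem_Icc.2 ⟨Nat.le_add_left 1 n, le_refl (n + 1)⟩) i v
  have hπ0 : ∀ n ω, 0 ≤ piMap d m α (occ d m W n ω) i v := fun n ω =>
    (piMap_mem_simplexD α hd _ i).1 v
  have hπ1 : ∀ n ω, piMap d m α (occ d m W n ω) i v ≤ 1 := fun n ω => by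
    rw [← (piMap_mem_simplexD α hd (occ d m W n ω) i).2]
    exact Finset.single_le_sum (fun u _ => (piMap_mem_simplexD α hd _ i).1 u) (Finset.mem_univ v)
  have hπint : ∀ n, Integrable (fun ω => piMap d m α (occ d m W n ω) i v) μ := fun n =>
    .of_bound ((hπ n).mono (ℱ.le n)).aestronglyMeasurable 1 (ae_of_all _ fun ω => by
      rw [Real.norm_of_nonneg (hπ0 n ω)]; exact hπ1 n ω)
  have hIint : ∀ n, Integrable (fun ω => if W (n + 1) ω i = v then (1 : ℝ) else 0) μ := fun n =>
    .of_bound ((hI n).mono (ℱ.le _)).aestronglyMeasurable 1 (ae_of_all _ fun ω => by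
      split_ifs <;> simp)
  refine ae_tendsto_average_of_condExp_eq_zero (ℱ := ℱ)
    (D := fun k ω => (if W (k + 1) ω i = v then (1 : ℝ) else 0)
      - piMap d m α (occ d m W k ω) i v)
    (fun n => (hI n).sub ((hπ n).mono (ℱ.mono n.le_succ))) (fun n ω => ?_) (fun n => ?_)
  · have h0 := hπ0 n ω
    have h1 := hπ1 n ω
    rw [abs_le]
    split_ifs <;> constructor <;> linarith
  · have h := condExp_sub (hIint n) (hπint n) (ℱ n)
    rw [condExp_of_stronglyMeasurable (ℱ.le n) (hπ n) (hπint n)] at h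
    filter_upwards [h, hcond n] with ω h1 h2
    refine h1.trans ?_
    simp [h2]

/-- If visits occur with asymptotic frequencies given by `piMap` along the trajectory, and `piMap`
is a contraction, then the occupation measures converge to the fixed point. -/
theorem tendsto_occ_of_tendsto_average (hd : 0 < d) (α : Fin d → Fin m → Fin m → ℝ)
    (hK : contractionConst α < 1) {x : Fin m → Fin d → ℝ} (hx : x ∈ simplexD d m)
    (hfix : piMap d m α x = x) (ω : Ω)
    (hω : ∀ i v, Tendsto (fun n : ℕ => (n : ℝ)⁻¹ * ∑ k ∈ Finset.range n,
      ((if W (k + 1) ω i = v then (1 : ℝ) else 0) - piMap d m α (occ d m W k ω) i v))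
      atTop (nhds 0)) :
    Tendsto (fun n => occ d m W n ω) atTop (nhds x) := by
  set X := fun n => occ d m W n ω with hX
  have hXmem : ∀ n, X n ∈ simplexD d m := fun n => occ_mem_simplexD W hd n ω
  set S : ℕ → Fin m → Fin d → ℝ := fun n i v => ∑ k ∈ Finset.range n,
      ((if W (k + 1) ω i = v then (1 : ℝ) else 0) - piMap d m α (X k) i v) with hS
  set e : ℕ → ℝ := fun n =>
    ∑ i, ∑ v, (|1 - d * x i v| * (n : ℝ)⁻¹ + |(n : ℝ)⁻¹ * S n i v|) with he
  have he0 : Tendsto e atTop (nhds 0) := by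
    have h : ∀ i v, Tendsto (fun n : ℕ => |1 - d * x i v| * (n : ℝ)⁻¹ + |(n : ℝ)⁻¹ * S n i v|)
        atTop (nhds 0) := fun i v => by
      simpa only [mul_zero, abs_zero, add_zero] using
        ((tendsto_inv_atTop_nhds_zero_nat (𝕜 := ℝ)).const_mul |1 - d * x i v|).add (hω i v).abs
    simpa only [Finset.sum_const_zero] using tendsto_finsetSum Finset.univ fun i _ =>
      tendsto_finsetSum Finset.univ fun v _ => h i v
  obtain ⟨B, hB⟩ := ((isCompact_simplexD d m).image
    (by fun_prop : Continuous fun y => maxL1 (y - x))).bddAbove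
  have hmain : ∀ᶠ n : ℕ in atTop, maxL1 (X n - x)
      ≤ contractionConst α * ((n : ℝ)⁻¹ * ∑ k ∈ Finset.range n, maxL1 (X k - x)) + e n := by
    filter_upwards [eventually_gt_atTop 0] with n hn
    have hn0 : (0 : ℝ) < n := by positivity
    have hterm0 : ∀ i v, 0 ≤ |1 - d * x i v| * (n : ℝ)⁻¹ + |(n : ℝ)⁻¹ * S n i v| :=
      fun i v => by positivity
    refine maxL1_le (add_nonneg (mul_nonneg (contractionConst_nonneg α) (mul_nonneg (by positivity)
      (Finset.sum_nonneg fun k _ => maxL1_nonneg _)))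
      (Finset.sum_nonneg fun i _ => Finset.sum_nonneg fun v _ => hterm0 i v)) fun i => ?_
    have hcoord : ∀ v, |(X n - x) i v| ≤ (n : ℝ)⁻¹ * (∑ k ∈ Finset.range n,
        |piMap d m α (X k) i v - piMap d m α x i v|)
        + (|1 - d * x i v| * (n : ℝ)⁻¹ + |(n : ℝ)⁻¹ * S n i v|) := fun v => by
      have hdn : (0 : ℝ) < d + n := by positivity
      have hid : (X n - x) i v = ((1 - d * x i v) + S n i v
          + ∑ k ∈ Finset.range n, (piMap d m α (X k) i v - piMap d m α x i v)) / (d + n) := by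
        simp only [Pi.sub_apply, hS, hX, occ_eq, Finset.sum_sub_distrib, hfix, Finset.sum_const,
          Finset.card_range, nsmul_eq_mul]
        field_simp
        ring
      rw [hid, abs_div, abs_of_pos hdn]
      have habs : |(1 - d * x i v) + S n i v
          + ∑ k ∈ Finset.range n, (piMap d m α (X k) i v - piMap d m α x i v)|
          ≤ |1 - d * x i v| + |S n i v|
            + ∑ k ∈ Finset.range n, |piMap d m α (X k) i v - piMap d m α x i v| :=
        (abs_add_three _ _ _).trans (by gcongr; exact Finset.abs_sum_le_sum_abs _ _)
      calc _ ≤ (|1 - d * x i v| + |S n i v| + ∑ k ∈ Finset.range n,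
            |piMap d m α (X k) i v - piMap d m α x i v|) / n := by
            gcongr
            linarith [(d.cast_nonneg : (0 : ℝ) ≤ d)]
        _ = _ := by
            rw [abs_mul, abs_of_pos (inv_pos.2 hn0)]
            ring
    calc ∑ v, |(X n - x) i v| ≤ _ := Finset.sum_le_sum fun v _ => hcoord v
      _ = (n : ℝ)⁻¹ * (∑ k ∈ Finset.range n,
            ∑ v, |piMap d m α (X k) i v - piMap d m α x i v|)
          + ∑ v, (|1 - d * x i v| * (n : ℝ)⁻¹ + |(n : ℝ)⁻¹ * S n i v|) := by
          rw [Finset.sum_add_distrib, ← Finset.mul_sum, Finset.sum_comm]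
      _ ≤ (n : ℝ)⁻¹ * (∑ k ∈ Finset.range n, contractionConst α * maxL1 (X k - x)) + e n := by
          gcongr with k
          · exact sum_abs_piMap_sub_le α hd (hXmem k) hx i
          · exact Finset.single_le_sum
              (f := fun i => ∑ v, (|1 - d * x i v| * (n : ℝ)⁻¹ + |(n : ℝ)⁻¹ * S n i v|))
              (fun i _ => Finset.sum_nonneg fun v _ => hterm0 i v) (Finset.mem_univ i)
      _ = _ := by
          rw [← Finset.mul_sum]
          ring
  have hlim := tendsto_zero_of_le_mul_cesaro (contractionConst_nonneg α) hK
    (fun n => maxL1_nonneg _) (fun n => hB ⟨X n, hXmem n, rfl⟩) he0 hmain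
  exact tendsto_iff_norm_sub_tendsto_zero.2
    (squeeze_zero (fun n => norm_nonneg _) (fun n => norm_le_maxL1 _) hlim)

end occ

/-- Weakly interacting random walks, condition (C3): if `α_v^{ii} = 0` and
`Σ_u Σ_{j ≠ i} |α_u^{ij}| < 4` for each `i`, then `F` has a unique equilibrium point `x*`
in `𝔇` and the occupation measure process converges almost surely to `x*`. -/
theorem as_convergence_unique_equilibrium (d m : ℕ) (hd : 2 ≤ d) (hm : 2 ≤ m)
    (α : Fin d → Fin m → Fin m → ℝ) (hsym : ∀ v i j, α v i j = α v j i)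
    (hdiag : ∀ v i, α v i i = 0)
    (hC3 : ∀ i : Fin m, ∑ u, ∑ j ∈ Finset.univ.erase i, |α u i j| < 4)
    {Ω : Type*} [MeasurableSpace Ω] (ℙ : Measure Ω) [IsProbabilityMeasure ℙ]
    (W : ℕ → Ω → Fin m → Fin d) (hWmeas : ∀ n, Measurable (W n))
    (ℱ : Filtration ℕ ‹MeasurableSpace Ω›)
    (hℱ : ∀ n, ℱ n = ⨆ k ∈ Finset.Icc 1 n, MeasurableSpace.comap (W k) ⊤)
    (hcond : ∀ n (i : Fin m) (v : Fin d),
      (ℙ[fun ω => if W (n + 1) ω i = v then (1 : ℝ) else 0 | ℱ n])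
        =ᵐ[ℙ] fun ω => piMap d m α (occ d m W n ω) i v)
    (hindep : ∀ n (v : Fin m → Fin d),
      (ℙ[fun ω => if (∀ i, W (n + 1) ω i = v i) then (1 : ℝ) else 0 | ℱ n])
        =ᵐ[ℙ] fun ω => ∏ i, piMap d m α (occ d m W n ω) i (v i)) :
    ∃ xstar : Fin m → Fin d → ℝ,
      xstar ∈ simplexD d m ∧ FF d m α xstar = 0 ∧
      (∀ y ∈ simplexD d m, FF d m α y = 0 → y = xstar) ∧
      ∀ᵐ ω ∂ℙ, Tendsto (fun n => occ d m W n ω) atTop (nhds xstar) := by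
  have hd0 : 0 < d := by omega
  have hK : contractionConst α < 1 := contractionConst_lt_one α fun i => by
    refine lt_of_eq_of_lt (Finset.sum_congr rfl fun u _ => ?_) (hC3 i)
    rw [← Finset.add_sum_erase _ _ (Finset.mem_univ i), hdiag, abs_zero, zero_add]
  obtain ⟨x, hx, hfix⟩ := exists_piMap_eq α hd0 hK
  refine ⟨x, hx, (FF_eq_zero_iff α x).2 hfix, fun y hy hFy => ?_, ?_⟩
  · have h := maxL1_piMap_sub_le α hd0 hy hx
    rw [(FF_eq_zero_iff α y).1 hFy, hfix] at h
    exact eq_of_maxL1_sub_le_mul hK h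
  · have hae : ∀ᵐ ω ∂ℙ, ∀ i v, Tendsto (fun n : ℕ => (n : ℝ)⁻¹ * ∑ k ∈ Finset.range n,
        ((if W (k + 1) ω i = v then (1 : ℝ) else 0) - piMap d m α (occ d m W k ω) i v))
        atTop (nhds 0) :=
      ae_all_iff.2 fun i => ae_all_iff.2 fun v =>
        ae_tendsto_average_visit_sub_piMap W hd0 hℱ α i v fun n => hcond n i v
    filter_upwards [hae] with ω hω
    exact tendsto_occ_of_tendsto_average W hd0 α hK hx hfix ω hω
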